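/- Let n ≥ 1 and 0 ≤ k < n. Then |C(n,k+1)·G_{k+1}| ≤ 7·(n/π)^{k+1}, where C(n,k+1) is the binomial coefficient and G_{k+1} is the (k+1)-st Genocchi number. -/

import Mathlib

open Nat Real

/-- The Genocchi number `G n = 2 * (1 - 2 ^ n) * B n` as a rational number, where
`B n` is the `n`-th Bernoulli number (e.g.f. `t / (e^t - 1)`, so `B 1 = -1/2`). -/
noncomputable def genocchi (n : ℕ) : ℚ := 2 * (1 - 2 ^ n) * bernoulli n

/-- The Genocchi number as an integer (each `G n` is in fact an integer, so its
numerator is the corresponding integer). -/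
noncomputable def genocchiZ (n : ℕ) : ℤ := (genocchi n).num

theorem Nat.Prime.dvd_two_mul_one_sub_two_pow {p m : ℕ} (hp : p.Prime) (hm : (p - 1) ∣ m) :
    (p : ℤ) ∣ 2 * (1 - 2 ^ m) := by
  have : Fact p.Prime := ⟨hp⟩
  rw [← ZMod.intCast_zmod_eq_zero_iff_dvd]
  push_cast
  by_cases h2 : (2 : ZMod p) = 0
  · rw [h2, zero_mul]
  · obtain ⟨c, rfl⟩ := hm
    rw [pow_mul, ZMod.pow_card_sub_one_eq_one h2, one_pow, sub_self, mul_zero]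

theorem genocchi_one : genocchi 1 = 1 := by
  norm_num [genocchi, bernoulli_one]

theorem genocchi_eq_zero_of_odd {n : ℕ} (hodd : Odd n) (hn : 1 < n) : genocchi n = 0 := by
  rw [genocchi, bernoulli_eq_zero_of_odd hodd hn, mul_zero]

theorem exists_intCast_eq_genocchi_two_mul (k : ℕ) : ∃ a : ℤ, (a : ℚ) = genocchi (2 * k) := by
  obtain ⟨b, hb⟩ := Bernoulli.vonStaudt_clausen k
  have hsum : ∃ c : ℤ, (c : ℚ) = 2 * (1 - 2 ^ (2 * k)) *
      ∑ p ∈ Finset.range (2 * k + 2) with p.Prime ∧ (p - 1) ∣ 2 * k, (1 : ℚ) / p := by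
    rw [Finset.mul_sum]
    refine ⟨∑ p ∈ Finset.range (2 * k + 2) with p.Prime ∧ (p - 1) ∣ 2 * k,
      2 * (1 - 2 ^ (2 * k)) / (p : ℤ), ?_⟩
    rw [Int.cast_sum]
    refine Finset.sum_congr rfl fun p hp => ?_
    obtain ⟨-, hp, hdvd⟩ := Finset.mem_filter.mp hp
    rw [Int.cast_div (hp.dvd_two_mul_one_sub_two_pow hdvd) (by exact_mod_cast hp.ne_zero)]
    push_cast
    ring
  obtain ⟨c, hc⟩ := hsum
  refine ⟨2 * (1 - 2 ^ (2 * k)) * b - c, ?_⟩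
  push_cast
  rw [hb, hc, genocchi]
  ring

theorem genocchiZ_two_mul_cast (k : ℕ) : (genocchiZ (2 * k) : ℚ) = genocchi (2 * k) := by
  obtain ⟨a, ha⟩ := exists_intCast_eq_genocchi_two_mul k
  rw [genocchiZ, ← ha, Rat.num_intCast]

theorem abs_bernoulli_two_mul_le {k : ℕ} (hk : k ≠ 0) :
    2 ^ (2 * k) * |(bernoulli (2 * k) : ℝ)| ≤ π ^ 2 / 3 * ((2 * k)! / π ^ (2 * k)) := by
  have hsum := hasSum_zeta_nat hk
  have hle := hasSum_le (fun n : ℕ => ?_) hsum hasSum_zeta_two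
  · have habs := abs_of_nonneg (hsum.nonneg fun n => by positivity)
    rw [← habs] at hle
    simp only [abs_mul, abs_div, abs_pow, abs_neg, abs_one, one_pow, one_mul, Nat.abs_cast,
      abs_two, abs_of_pos pi_pos] at hle
    rw [div_le_iff₀ (by positivity)] at hle
    rw [← mul_div_assoc, le_div_iff₀ (by positivity),
      ← mul_pow_sub_one (show 2 * k ≠ 0 by lia) (2 : ℝ)]
    linarith
  · rcases Nat.eq_zero_or_pos n with rfl | hn
    · simp [hk]
    · have : (1 : ℝ) ≤ n := by exact_mod_cast hn
      gcongr
      lia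

theorem abs_genocchiZ_two_mul_le {k : ℕ} (hk : k ≠ 0) :
    |(genocchiZ (2 * k) : ℝ)| ≤ 7 * ((2 * k)! / π ^ (2 * k)) := by
  have hcast : (genocchiZ (2 * k) : ℝ) = 2 * (1 - 2 ^ (2 * k)) * bernoulli (2 * k) := by
    have h := congrArg (Rat.cast : ℚ → ℝ) (genocchiZ_two_mul_cast k)
    simpa [genocchi] using h
  have h1 : (1 : ℝ) ≤ 2 ^ (2 * k) := one_le_pow₀ one_le_two
  have hpi : π ^ 2 ≤ 10.5 := by nlinarith [pi_pos, pi_lt_d2]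
  have hfac : 0 ≤ ((2 * k)! : ℝ) / π ^ (2 * k) := by positivity
  calc |(genocchiZ (2 * k) : ℝ)|
      = 2 * ((2 ^ (2 * k) - 1) * |(bernoulli (2 * k) : ℝ)|) := by
        rw [hcast, abs_mul, abs_mul, abs_two, abs_sub_comm, abs_of_nonneg (sub_nonneg.mpr h1),
          mul_assoc]
    _ ≤ 2 * (2 ^ (2 * k) * |(bernoulli (2 * k) : ℝ)|) := by
        gcongr
        exact sub_le_self _ zero_le_one
    _ ≤ 2 * (π ^ 2 / 3 * ((2 * k)! / π ^ (2 * k))) := by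
        exact mul_le_mul_of_nonneg_left (abs_bernoulli_two_mul_le hk) zero_le_two
    _ ≤ 7 * ((2 * k)! / π ^ (2 * k)) := by nlinarith

theorem abs_genocchiZ_le {m : ℕ} (hm : m ≠ 0) :
    |(genocchiZ m : ℝ)| ≤ 7 * (m ! / π ^ m) := by
  rcases Nat.even_or_odd' m with ⟨k, rfl | rfl⟩
  · exact abs_genocchiZ_two_mul_le (by lia)
  · rcases Nat.eq_zero_or_pos k with rfl | hk
    · have : π ≤ 7 := by linarith [pi_lt_d2]
      simpa [genocchiZ, genocchi_one, ← div_eq_mul_inv] using (one_le_div pi_pos).mpr this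
    · rw [genocchiZ, genocchi_eq_zero_of_odd (odd_two_mul_add_one k) (by lia)]
      simp only [Rat.num_zero, Int.cast_zero, abs_zero]
      positivity

/-- For `n ≥ 1` and `0 ≤ k < n`, `|C(n,k+1) G_{k+1}| ≤ 7 (n/π)^(k+1)`. -/
theorem abs_choose_mul_genocchi_le (n k : ℕ) (hn : 1 ≤ n) (hk : k < n) :
    |(n.choose (k + 1) : ℝ) * (genocchiZ (k + 1) : ℝ)| ≤
      7 * ((n : ℝ) / π) ^ (k + 1) := by
  have hchoose : (n.choose (k + 1) : ℝ) * (k + 1)! ≤ (n : ℝ) ^ (k + 1) := by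
    have h := Nat.descFactorial_le_pow n (k + 1)
    rw [Nat.descFactorial_eq_factorial_mul_choose, mul_comm] at h
    exact_mod_cast h
  calc |(n.choose (k + 1) : ℝ) * (genocchiZ (k + 1) : ℝ)|
      = n.choose (k + 1) * |(genocchiZ (k + 1) : ℝ)| := by rw [abs_mul, Nat.abs_cast]
    _ ≤ n.choose (k + 1) * (7 * ((k + 1)! / π ^ (k + 1))) := by
        gcongr
        exact abs_genocchiZ_le k.succ_ne_zero
    _ = 7 * (n.choose (k + 1) * (k + 1)! / π ^ (k + 1)) := by ring
    _ ≤ 7 * ((n : ℝ) / π) ^ (k + 1) := by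
        rw [div_pow]
        gcongr
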